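/- arXiv:1601.07316 — 2 statements merged into one kernel-verified Lean document; each statement's English description precedes it below -/
import Mathlib

section
/- Let K be a field with char(K) = 0 and f ∈ K[x] with deg f > 1. Then f is indecomposable over K if and only if f is indecomposable over an algebraic closure of K. -/
open Polynomial

noncomputable section

/-- `f ∈ R[x]` is indecomposable (over `R`): it is not a composition of two polynomials
over `R` of degree `> 1`. -/
def Indecomposable {R : Type*} [CommSemiring R] (f : R[X]) : Prop :=
  ¬ ∃ g h : R[X], 1 < g.natDegree ∧ 1 < h.natDegree ∧ f = g.comp h

/-- Composition on the right with a nonconstant polynomial over a domain is injective. -/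
theorem comp_right_injective {R : Type*} [CommRing R] [IsDomain R] {h : R[X]}
    (hh : h.natDegree ≠ 0) : Function.Injective fun g : R[X] => g.comp h := by
  intro g g' e
  have e0 : (g - g').comp h = 0 := by simpa [sub_comp, sub_eq_zero] using e
  rcases comp_eq_zero_iff.mp e0 with h0 | ⟨-, h1⟩
  · exact sub_eq_zero.mp h0
  · exact absurd (by rw [h1, natDegree_C]) hh

theorem coeff_geom_sum₂_of_monic {R : Type*} [CommRing R] {h h' : R[X]}
    (hm : h.Monic) (hm' : h'.Monic) (hd : h.natDegree = h'.natDegree) (n : ℕ) :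
    (∑ i ∈ Finset.range n, h ^ i * h' ^ (n - 1 - i)).coeff ((n - 1) * h.natDegree) = n := by
  rw [finsetSum_coeff, Finset.sum_congr rfl (g := fun _ => (1 : R))]
  · simp
  · intro i hi
    have hmon : (h ^ i * h' ^ (n - 1 - i)).Monic := (hm.pow i).mul (hm'.pow _)
    have hdeg : (h ^ i * h' ^ (n - 1 - i)).natDegree = (n - 1) * h.natDegree := by
      rw [(hm.pow i).natDegree_mul (hm'.pow _), hm.natDegree_pow, hm'.natDegree_pow, ← hd,
        ← add_mul]
      congr 1
      have := Finset.mem_range.mp hi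
      omega
    rw [← hdeg]
    exact hmon.coeff_natDegree

/-- In characteristic zero, the monic right factor without constant term of a given degree in a
decomposition of a polynomial is unique. -/
theorem right_factor_unique {L : Type*} [Field L] [CharZero L] {g g' h h' : L[X]}
    (hg : g.natDegree ≠ 0) (hh : h.natDegree ≠ 0) (hd : h.natDegree = h'.natDegree)
    (hm : h.Monic) (hm' : h'.Monic) (h0 : h.coeff 0 = 0) (h0' : h'.coeff 0 = 0)
    (e : g.comp h = g'.comp h') : h = h' := by
  have hh' : h'.natDegree ≠ 0 := hd ▸ hh
  have hdg : g.natDegree = g'.natDegree := by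
    have := congrArg natDegree e
    rw [natDegree_comp, natDegree_comp, ← hd] at this
    exact Nat.eq_of_mul_eq_mul_right (Nat.pos_of_ne_zero hh) this
  have hlc : g.leadingCoeff = g'.leadingCoeff := by
    have := congrArg leadingCoeff e
    simpa [leadingCoeff_comp hh, leadingCoeff_comp hh', hm.leadingCoeff, hm'.leadingCoeff]
      using this
  have hc : g.leadingCoeff ≠ 0 := by
    rw [Ne, leadingCoeff_eq_zero]
    rintro rfl
    simp at hg
  have expand (p q : L[X]) :
      p.comp q = p.eraseLead.comp q + C p.leadingCoeff * q ^ p.natDegree := by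
    simpa only [add_comp, mul_comp, C_comp, pow_comp, X_comp] using
      congrArg (comp · q) (eraseLead_add_C_mul_X_pow p).symm
  have key : C g.leadingCoeff * (h ^ g.natDegree - h' ^ g.natDegree) =
      g'.eraseLead.comp h' - g.eraseLead.comp h := by
    rw [expand g h, expand g' h', ← hdg, ← hlc] at e
    linear_combination e
  have hle : (h ^ g.natDegree - h' ^ g.natDegree).natDegree ≤
      (g.natDegree - 1) * h.natDegree := by
    rw [← natDegree_C_mul hc, key]
    refine (natDegree_sub_le _ _).trans (max_le ?_ ?_)
    · refine natDegree_comp_le.trans ?_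
      rw [hdg, hd]
      exact Nat.mul_le_mul_right _ (eraseLead_natDegree_le _)
    · exact natDegree_comp_le.trans (Nat.mul_le_mul_right _ (eraseLead_natDegree_le _))
  by_contra hne
  have hsub : h - h' ≠ 0 := sub_ne_zero.mpr hne
  have hcoeff : (∑ i ∈ Finset.range g.natDegree, h ^ i * h' ^ (g.natDegree - 1 - i)).coeff
      ((g.natDegree - 1) * h.natDegree) ≠ 0 := by
    rw [coeff_geom_sum₂_of_monic hm hm' hd]
    exact Nat.cast_ne_zero.mpr hg
  have hS := le_natDegree_of_ne_zero hcoeff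
  have hS0 : (∑ i ∈ Finset.range g.natDegree, h ^ i * h' ^ (g.natDegree - 1 - i)) ≠ 0 := by
    intro hz
    simp [hz] at hcoeff
  rw [← geom_sum₂_mul, natDegree_mul hS0 hsub] at hle
  have hconst : (h - h').natDegree = 0 := by omega
  rw [natDegree_eq_zero] at hconst
  obtain ⟨a, ha⟩ := hconst
  apply hsub
  have := congrArg (coeff · 0) ha
  have ha0 : a = 0 := by simpa [h0, h0'] using this
  rw [← ha, ha0, C_0]

/-- Every decomposition over a field can be normalized so that the right factor is monic
without constant term. -/
theorem exists_normalized_comp {L : Type*} [Field L] (g h : L[X]) (hh : h.natDegree ≠ 0) :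
    ∃ g' h' : L[X], g'.natDegree = g.natDegree ∧ h'.natDegree = h.natDegree ∧
      h'.Monic ∧ h'.coeff 0 = 0 ∧ g'.comp h' = g.comp h := by
  have hc : h.leadingCoeff ≠ 0 := by
    rw [Ne, leadingCoeff_eq_zero]
    rintro rfl
    simp at hh
  have hd : (h - C (h.coeff 0)).natDegree = h.natDegree := natDegree_sub_C
  have hl : (h - C (h.coeff 0)).leadingCoeff = h.leadingCoeff := by
    rw [leadingCoeff, hd, coeff_sub, coeff_C_of_ne_zero hh, sub_zero, leadingCoeff]
  refine ⟨g.comp (C h.leadingCoeff * X + C (h.coeff 0)),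
    C h.leadingCoeff⁻¹ * (h - C (h.coeff 0)), ?_, ?_, ?_, ?_, ?_⟩
  · rw [natDegree_comp, natDegree_linear hc, mul_one]
  · rw [natDegree_C_mul (inv_ne_zero hc), hd]
  · rw [Monic, leadingCoeff_mul, leadingCoeff_C, hl, inv_mul_cancel₀ hc]
  · simp
  · rw [comp_assoc]
    congr 1
    simp [← mul_assoc, ← C_mul, hc]

theorem mem_range_map_of_fixed {K L : Type*} [Field K] [Field L] [Algebra K L] [IsGalois K L]
    (p : L[X]) (hp : ∀ σ : Gal(L/K), p.map (σ : L →+* L) = p) :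
    ∃ q : K[X], q.map (algebraMap K L) = p := by
  rw [← mem_lifts, lifts_iff_coeff_lifts]
  intro n
  rw [InfiniteGalois.mem_range_algebraMap_iff_fixed]
  intro σ
  simpa using congrArg (coeff · n) (hp σ)

/-- **Proposition (Fried–McRae).** Let `char K = 0` and `f ∈ K[x]` with `deg f > 1`. Then `f`
is indecomposable over `K` iff it is indecomposable over an algebraic closure of `K`. -/
theorem stmt11 {K : Type*} [Field K] [CharZero K] (f : K[X]) (hf : 1 < f.natDegree) :
    Indecomposable f ↔ Indecomposable (f.map (algebraMap K (AlgebraicClosure K))) := by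
  have hinj := (algebraMap K (AlgebraicClosure K)).injective
  refine not_congr ⟨?_, ?_⟩
  · rintro ⟨g, h, hg, hh, rfl⟩
    exact ⟨g.map _, h.map _, by rwa [natDegree_map], by rwa [natDegree_map], map_comp _ _ _⟩
  · rintro ⟨g₀, h₀, hg₀, hh₀, e₀⟩
    obtain ⟨g, h, hdg, hdh, hm, h0, e⟩ := exists_normalized_comp g₀ h₀ (by omega)
    rw [← e] at e₀
    have hσ (σ : Gal(AlgebraicClosure K/K)) : g.comp h =
        (g.map (σ : AlgebraicClosure K →+* AlgebraicClosure K)).comp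
          (h.map (σ : AlgebraicClosure K →+* AlgebraicClosure K)) := by
      rw [← map_comp, ← e₀, map_map]
      congr 1
      ext x
      simp
    have hfix (σ : Gal(AlgebraicClosure K/K)) :
        h.map (σ : AlgebraicClosure K →+* AlgebraicClosure K) = h :=
      (right_factor_unique (by omega) (by omega) (natDegree_map _).symm hm (hm.map _) h0
        (by simp [h0]) (hσ σ)).symm
    have gfix (σ : Gal(AlgebraicClosure K/K)) :
        g.map (σ : AlgebraicClosure K →+* AlgebraicClosure K) = g := by
      have := hσ σ
      rw [hfix σ] at this
      exact (comp_right_injective (by omega) this).symm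
    obtain ⟨h₁, rfl⟩ := mem_range_map_of_fixed h hfix
    obtain ⟨g₁, rfl⟩ := mem_range_map_of_fixed g gfix
    rw [natDegree_map] at hdg hdh
    refine ⟨g₁, h₁, by omega, by omega, map_injective _ hinj ?_⟩
    rw [e₀, map_comp]
end
end

section
/- For every nonzero rational number d and every integer m ≥ 3, the polynomial f(x) = x(x + d)(x + 2d)⋯(x + (m − 1)d) has at least two distinct critical points, and there are no three pairwise distinct critical points of f at which f takes the same value. -/
open Polynomial

noncomputable section

/-- The polynomial `x(x + d)(x + 2d)⋯(x + (m − 1)d)` with rational coefficients. -/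
def prodShift (d : ℚ) (m : ℕ) : ℚ[X] :=
  ∏ j ∈ Finset.range m, (X + C ((j : ℚ) * d))

lemma prodShift_natDegree (d : ℚ) (m : ℕ) : (prodShift d m).natDegree = m := by
  unfold prodShift
  rw [natDegree_prod_of_monic _ _ fun j _ => monic_X_add_C _]
  simp only [natDegree_X_add_C, Finset.sum_const, Finset.card_range, smul_eq_mul, mul_one]

lemma prodShift_eq_comp (d : ℚ) (hd : d ≠ 0) (m : ℕ) :
    prodShift d m = C ((-d) ^ m) * (prodShift (-1) m).comp (C (-d⁻¹) * X) := by
  have h : C ((-d) ^ m) = ∏ _j ∈ Finset.range m, (C (-d) : ℚ[X]) := by simp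
  rw [h]
  unfold prodShift
  rw [prod_comp, ← Finset.prod_mul_distrib]
  refine Finset.prod_congr rfl fun j _ => ?_
  rw [add_comp, X_comp, C_comp, mul_add, ← mul_assoc, ← C_mul, ← C_mul]
  have h1 : -d * -d⁻¹ = 1 := by field_simp
  rw [h1]
  simp [mul_comm]

lemma aeval_prodShift (d : ℚ) (hd : d ≠ 0) (m : ℕ) (z : ℂ) :
    aeval z (prodShift d m) = (-d : ℂ) ^ m * aeval (-(d : ℂ)⁻¹ * z) (prodShift (-1) m) := by
  rw [prodShift_eq_comp d hd m]
  simp [aeval_comp]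

lemma aeval_derivative_prodShift (d : ℚ) (hd : d ≠ 0) (m : ℕ) (z : ℂ) :
    aeval z (derivative (prodShift d m)) = 0 ↔
      aeval (-(d : ℂ)⁻¹ * z) (derivative (prodShift (-1) m)) = 0 := by
  rw [prodShift_eq_comp d hd m]
  rw [derivative_C_mul, derivative_comp, derivative_C_mul, derivative_X]
  simp only [map_mul, aeval_comp, aeval_C, aeval_X, mul_eq_zero, map_neg, map_pow, map_inv₀,
    map_one]
  simp [hd]

lemma aeval_prodShift_neg_one (m : ℕ) (x : ℝ) :
    aeval x (prodShift (-1) m) = ∏ j ∈ Finset.range m, (x - j) := by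
  simp [prodShift, sub_eq_add_neg]

lemma aeval_prodShift_neg_one_reflect (m : ℕ) (x : ℝ) :
    |aeval ((m : ℝ) - 1 - x) (prodShift (-1) m)| = |aeval x (prodShift (-1) m)| := by
  rw [aeval_prodShift_neg_one, aeval_prodShift_neg_one, Finset.abs_prod, Finset.abs_prod,
    ← Finset.prod_range_reflect]
  refine Finset.prod_congr rfl fun j hj => ?_
  have hj := Finset.mem_range.1 hj
  rw [Nat.sub_sub, Nat.cast_sub (by omega), abs_sub_comm]
  congr 1
  push_cast
  ring

lemma aeval_prodShift_neg_one_shift (m : ℕ) (x : ℝ) :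
    (m - x) * aeval x (prodShift (-1) m) = -x * aeval (x - 1) (prodShift (-1) m) := by
  rw [aeval_prodShift_neg_one, aeval_prodShift_neg_one]
  have h1 := Finset.prod_range_succ (fun j : ℕ => x - (j : ℝ)) m
  have h2 := Finset.prod_range_succ' (fun j : ℕ => x - (j : ℝ)) m
  have h3 : ∀ j : ℕ, x - ((j + 1 : ℕ) : ℝ) = x - 1 - j := fun j => by push_cast; ring
  simp only [h3, Nat.cast_zero, sub_zero] at h2
  linear_combination h1 - h2

/-- Between consecutive zeros there is a critical point at which the absolute value is maximal. -/
lemma exists_critical_isMax (m j : ℕ) (hj : j + 1 < m) :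
    ∃ t : ℝ, (j : ℝ) < t ∧ t < j + 1 ∧ aeval t (derivative (prodShift (-1) m)) = 0 ∧
      aeval t (prodShift (-1) m) ≠ 0 ∧
      ∀ y : ℝ, (j : ℝ) ≤ y → y ≤ j + 1 →
        |aeval y (prodShift (-1) m)| ≤ |aeval t (prodShift (-1) m)| := by
  set g : ℝ → ℝ := fun x => aeval x (prodShift (-1) m) with hg
  have hgv : ∀ x, g x = ∏ j ∈ Finset.range m, (x - j) := aeval_prodShift_neg_one m
  have hcont : Continuous fun x => g x ^ 2 := by fun_prop
  obtain ⟨t, ⟨ht1, ht2⟩, hmax⟩ := (isCompact_Icc (a := (j : ℝ)) (b := j + 1)).exists_isMaxOn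
    ⟨j, by simp⟩ hcont.continuousOn
  have hle : ∀ y : ℝ, (j : ℝ) ≤ y → y ≤ j + 1 → g y ^ 2 ≤ g t ^ 2 := fun y h1 h2 =>
    hmax ⟨h1, h2⟩
  have hmid : g (j + 1 / 2) ≠ 0 := by
    rw [hgv, Finset.prod_ne_zero_iff]
    intro i _ h
    have h' : (2 * j + 1 : ℝ) = 2 * i := by linarith
    have h'' : 2 * j + 1 = 2 * i := by exact_mod_cast h'
    omega
  have hne : g t ≠ 0 := by
    intro h
    have h1 := hle (j + 1 / 2) (by linarith) (by linarith)
    rw [h] at h1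
    exact hmid (by nlinarith [sq_nonneg (g (j + 1 / 2))])
  have hz : ∀ i < m, g i = 0 := fun i hi => by
    rw [hgv]
    exact Finset.prod_eq_zero (Finset.mem_range.2 hi) (sub_self _)
  have h1 : (j : ℝ) < t := lt_of_le_of_ne ht1 fun h => hne (h ▸ hz j (by omega))
  have h2 : t < j + 1 := lt_of_le_of_ne ht2 fun h => hne (by
    have := hz (j + 1) hj
    push_cast at this
    rwa [h])
  refine ⟨t, h1, h2, ?_, hne, fun y hy1 hy2 => sq_le_sq.1 (hle y hy1 hy2)⟩
  have hd := ((prodShift (-1) m).hasDerivAt_aeval t).pow 2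
  have hloc : IsLocalMax (fun x => g x ^ 2) t := hmax.isLocalMax (Icc_mem_nhds h1 h2)
  have h0 := hloc.hasDerivAt_eq_zero hd
  have hne' : aeval t (prodShift (-1) m) ≠ 0 := hne
  simpa [hne'] using h0

/-- The maxima of the absolute value on consecutive intervals take no value three times. -/
lemma eq_of_three_equal_maxima (m : ℕ) (t : ℕ → ℝ)
    (ht : ∀ j, j + 1 < m → (j : ℝ) < t j ∧ t j < j + 1 ∧ aeval (t j) (prodShift (-1) m) ≠ 0 ∧
      ∀ y : ℝ, (j : ℝ) ≤ y → y ≤ j + 1 →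
        |aeval y (prodShift (-1) m)| ≤ |aeval (t j) (prodShift (-1) m)|)
    {i j k : ℕ} (hi : i + 1 < m) (hj : j + 1 < m) (hk : k + 1 < m)
    (hij : |aeval (t i) (prodShift (-1) m)| = |aeval (t j) (prodShift (-1) m)|)
    (hjk : |aeval (t j) (prodShift (-1) m)| = |aeval (t k) (prodShift (-1) m)|) :
    i = j ∨ i = k ∨ j = k := by
  set M : ℕ → ℝ := fun j => |aeval (t j) (prodShift (-1) m)| with hM
  have step : ∀ j, 2 * j + 4 ≤ m → M (j + 1) < M j := by
    intro j hj
    obtain ⟨h1, h2, h3, -⟩ := ht (j + 1) (by omega)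
    obtain ⟨-, -, -, h4⟩ := ht j (by omega)
    push_cast at h1 h2
    have hs := congrArg abs (aeval_prodShift_neg_one_shift m (t (j + 1)))
    have hm : (2 * j + 4 : ℝ) ≤ m := by exact_mod_cast hj
    have hj0 : (0 : ℝ) ≤ j := j.cast_nonneg
    rw [abs_mul, abs_mul, abs_neg, abs_of_pos (show 0 < (m : ℝ) - t (j + 1) by linarith),
      abs_of_pos (show 0 < t (j + 1) by linarith)] at hs
    have h5 := h4 (t (j + 1) - 1) (by linarith) (by linarith)
    have h6 : 0 < M (j + 1) := abs_pos.2 h3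
    refine lt_of_lt_of_le ?_ h5
    change ((m : ℝ) - t (j + 1)) * M (j + 1) = _ at hs
    have h7 : t (j + 1) * M (j + 1) < ((m : ℝ) - t (j + 1)) * M (j + 1) :=
      mul_lt_mul_of_pos_right (by linarith) h6
    rw [hs] at h7
    exact lt_of_mul_lt_mul_left h7 (by linarith)
  have anti : ∀ i n, 2 * (i + n + 1) + 2 ≤ m → M (i + n + 1) < M i := by
    intro i n
    induction n with
    | zero => exact fun h => step i (by omega)
    | succ n ih => exact fun h => (step (i + n + 1) (by omega)).trans (ih (by omega))
  have inj : ∀ a b, 2 * a + 2 ≤ m → 2 * b + 2 ≤ m → M a = M b → a = b := by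
    intro a b ha hb h
    rcases lt_trichotomy a b with hab | hab | hab
    · obtain ⟨n, rfl⟩ := Nat.exists_eq_add_of_lt hab
      exact absurd h (anti a n hb).ne'
    · exact hab
    · obtain ⟨n, rfl⟩ := Nat.exists_eq_add_of_lt hab
      exact absurd h (anti b n ha).ne
  have reflect_le : ∀ a b, a + b + 2 = m → M a ≤ M b := by
    intro a b hab
    obtain ⟨h1, h2, -, -⟩ := ht a (by omega)
    obtain ⟨-, -, -, h4⟩ := ht b (by omega)
    have hm : (a + b + 2 : ℝ) = m := by exact_mod_cast hab
    have h5 := h4 (m - 1 - t a) (by linarith) (by linarith)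
    rwa [aeval_prodShift_neg_one_reflect] at h5
  have fold : ∀ a, a + 1 < m → M a = M (min a (m - 2 - a)) := by
    intro a ha
    rcases le_total a (m - 2 - a) with h | h
    · rw [min_eq_left h]
    · rw [min_eq_right h]
      exact le_antisymm (reflect_le _ _ (by omega)) (reflect_le _ _ (by omega))
  have e1 := inj _ _ (by omega) (by omega) ((fold i hi).symm.trans (hij.trans (fold j hj)))
  have e2 := inj _ _ (by omega) (by omega) ((fold j hj).symm.trans (hjk.trans (fold k hk)))
  omega

/-- If `t` picks a critical point in each interval between consecutive zeros, there are no other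
complex critical points. -/
lemma exists_eq_of_critical (m : ℕ) (t : ℕ → ℝ)
    (ht : ∀ j, j + 1 < m → (j : ℝ) < t j ∧ t j < j + 1 ∧
      aeval (t j) (derivative (prodShift (-1) m)) = 0)
    (hm : 0 < m) {z : ℂ} (hz : aeval z (derivative (prodShift (-1) m)) = 0) :
    ∃ j, j + 1 < m ∧ z = t j := by
  have h0 : derivative (prodShift (-1) m) ≠ 0 := by
    intro h
    have := derivative_eq_zero.1 h
    rw [prodShift_natDegree] at this
    omega
  have hinj : Set.InjOn (fun j => (t j : ℂ)) (Finset.range (m - 1)) := by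
    intro a ha b hb hab
    simp only [Finset.coe_range, Set.mem_Iio] at ha hb
    obtain ⟨a1, a2, -⟩ := ht a (by omega)
    obtain ⟨b1, b2, -⟩ := ht b (by omega)
    have hab : t a = t b := Complex.ofReal_injective hab
    have h1 : (a : ℝ) < b + 1 := by linarith
    have h2 : (b : ℝ) < a + 1 := by linarith
    norm_cast at h1 h2
    omega
  have hsub : (Finset.range (m - 1)).image (fun j => (t j : ℂ)) ⊆
      ((derivative (prodShift (-1) m)).aroots ℂ).toFinset := by
    intro w hw
    obtain ⟨j, hj, rfl⟩ := Finset.mem_image.1 hw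
    have hj := Finset.mem_range.1 hj
    rw [Multiset.mem_toFinset, mem_aroots]
    refine ⟨h0, ?_⟩
    have := aeval_algebraMap_apply ℂ (t j) (derivative (prodShift (-1) m))
    rw [(ht j (by omega)).2.2] at this
    simpa using this
  have hcard : ((derivative (prodShift (-1) m)).aroots ℂ).toFinset.card ≤
      ((Finset.range (m - 1)).image (fun j => (t j : ℂ))).card := by
    rw [Finset.card_image_of_injOn hinj, Finset.card_range]
    refine (Multiset.toFinset_card_le _).trans ((card_roots' _).trans ?_)
    refine natDegree_map_le.trans ((natDegree_derivative_le _).trans ?_)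
    rw [prodShift_natDegree]
  have hmem : z ∈ ((derivative (prodShift (-1) m)).aroots ℂ).toFinset := by
    rw [Multiset.mem_toFinset, mem_aroots]
    exact ⟨h0, hz⟩
  rw [← Finset.eq_of_subset_of_card_le hsub hcard] at hmem
  obtain ⟨j, hj, rfl⟩ := Finset.mem_image.1 hmem
  exact ⟨j, by have := Finset.mem_range.1 hj; omega, rfl⟩

/-- **Lemma (Beukers–Shorey–Tijdeman).** For every nonzero rational `d` and every `m ≥ 3`, the
polynomial `f(x) = x(x + d)⋯(x + (m − 1)d)` has at least two distinct complex critical points,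
and there are no three pairwise distinct critical points of `f` at which `f` takes the same
value. -/
theorem stmt18 (d : ℚ) (hd : d ≠ 0) (m : ℕ) (hm : 3 ≤ m) :
    (∃ α β : ℂ, α ≠ β ∧
      aeval α (derivative (prodShift d m)) = 0 ∧ aeval β (derivative (prodShift d m)) = 0) ∧
    ¬ ∃ α β γ : ℂ, α ≠ β ∧ α ≠ γ ∧ β ≠ γ ∧
      aeval α (derivative (prodShift d m)) = 0 ∧ aeval β (derivative (prodShift d m)) = 0 ∧
      aeval γ (derivative (prodShift d m)) = 0 ∧
      aeval α (prodShift d m) = aeval β (prodShift d m) ∧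
      aeval β (prodShift d m) = aeval γ (prodShift d m) := by
  have hdC : (d : ℂ) ≠ 0 := by exact_mod_cast hd
  have hex : ∀ j, ∃ t : ℝ, j + 1 < m → (j : ℝ) < t ∧ t < j + 1 ∧
      aeval t (derivative (prodShift (-1) m)) = 0 ∧ aeval t (prodShift (-1) m) ≠ 0 ∧
      ∀ y : ℝ, (j : ℝ) ≤ y → y ≤ j + 1 →
        |aeval y (prodShift (-1) m)| ≤ |aeval t (prodShift (-1) m)| := by
    intro j
    by_cases hj : j + 1 < m
    · obtain ⟨t, ht⟩ := exists_critical_isMax m j hj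
      exact ⟨t, fun _ => ht⟩
    · exact ⟨0, fun h => absurd h hj⟩
  choose t ht using hex
  have hofReal : ∀ (x : ℝ) (p : ℚ[X]), aeval (x : ℂ) p = ((aeval x p : ℝ) : ℂ) :=
    fun x p => aeval_algebraMap_apply ℂ x p
  constructor
  · have key : ∀ j, j + 1 < m → aeval (-(d : ℂ) * t j) (derivative (prodShift d m)) = 0 := by
      intro j hj
      rw [aeval_derivative_prodShift d hd, ← mul_assoc,
        show -(d : ℂ)⁻¹ * -(d : ℂ) = 1 by field_simp, one_mul, hofReal, (ht j hj).2.2.1,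
        Complex.ofReal_zero]
    refine ⟨-(d : ℂ) * t 0, -(d : ℂ) * t 1, fun h => ?_, key 0 (by omega), key 1 (by omega)⟩
    have h' : t 0 = t 1 := Complex.ofReal_injective (mul_left_cancel₀ (neg_ne_zero.2 hdC) h)
    have h0 := (ht 0 (by omega)).2.1
    have h1 := (ht 1 (by omega)).1
    push_cast at h0 h1
    linarith
  · rintro ⟨α, β, γ, hαβ, hαγ, hβγ, hα, hβ, hγ, e1, e2⟩
    rw [aeval_derivative_prodShift d hd] at hα hβ hγ
    rw [aeval_prodShift d hd, aeval_prodShift d hd m β] at e1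
    rw [aeval_prodShift d hd, aeval_prodShift d hd m γ] at e2
    have hpow : (-(d : ℂ)) ^ m ≠ 0 := pow_ne_zero _ (neg_ne_zero.2 hdC)
    replace e1 := mul_left_cancel₀ hpow e1
    replace e2 := mul_left_cancel₀ hpow e2
    have ht' : ∀ j, j + 1 < m → (j : ℝ) < t j ∧ t j < j + 1 ∧
        aeval (t j) (derivative (prodShift (-1) m)) = 0 :=
      fun j hj => ⟨(ht j hj).1, (ht j hj).2.1, (ht j hj).2.2.1⟩
    obtain ⟨i, hi, hi'⟩ := exists_eq_of_critical m t ht' (by omega) hα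
    obtain ⟨j, hj, hj'⟩ := exists_eq_of_critical m t ht' (by omega) hβ
    obtain ⟨k, hk, hk'⟩ := exists_eq_of_critical m t ht' (by omega) hγ
    rw [hi', hj', hofReal, hofReal] at e1
    rw [hj', hk', hofReal, hofReal] at e2
    have hcancel : -(d : ℂ)⁻¹ ≠ 0 := neg_ne_zero.2 (inv_ne_zero hdC)
    rcases eq_of_three_equal_maxima m t
      (fun j hj => ⟨(ht j hj).1, (ht j hj).2.1, (ht j hj).2.2.2⟩) hi hj hk
      (congrArg abs (Complex.ofReal_injective e1)) (congrArg abs (Complex.ofReal_injective e2))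
      with rfl | rfl | rfl
    · exact hαβ (mul_left_cancel₀ hcancel (hi'.trans hj'.symm))
    · exact hαγ (mul_left_cancel₀ hcancel (hi'.trans hk'.symm))
    · exact hβγ (mul_left_cancel₀ hcancel (hj'.trans hk'.symm))
end
end
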